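/- arXiv:2506.07817 — 8 statements merged into one kernel-verified Lean document; each statement's English description precedes it below -/
import Mathlib

section
/- Let q ≥ 2, b ≥ 1 and n ≥ b+1, and let x ∈ Σ_q^n. Then the set of sequences of Σ_q^n obtainable from x by one burst of b deletions followed by one burst of b insertions equals the set of sequences obtainable from x by one burst of b insertions followed by one burst of b deletions; that is, ⋃_{y ∈ D_1^b(x)} I_1^b(y) = ⋃_{w ∈ I_1^b(x)} D_1^b(w). -/
/-- `BurstDel b x y` : `y` is obtained from `x` by one burst of `b` deletions,
i.e. by deleting `b` consecutive entries. -/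
def BurstDel {q : ℕ} (b : ℕ) (x y : List (Fin q)) : Prop :=
  ∃ i : ℕ, i + b ≤ x.length ∧ y = x.take i ++ x.drop (i + b)

/-- `BurstIns b x y` : `y` is obtained from `x` by one burst of `b` insertions,
i.e. by inserting an arbitrary block of `b` consecutive entries. -/
def BurstIns {q : ℕ} (b : ℕ) (x y : List (Fin q)) : Prop :=
  ∃ (i : ℕ) (v : List (Fin q)), i ≤ x.length ∧ v.length = b ∧
    y = x.take i ++ v ++ x.drop i

/-- `relIter R t` : `t`-fold composition of the relation `R`. -/
def relIter {α : Type*} (R : α → α → Prop) : ℕ → α → α → Prop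
  | 0 => Eq
  | t + 1 => fun x y => ∃ z, R x z ∧ relIter R t z y

/-- The `b`-burst-deletion ball of radius `t` centered at `x`. -/
def delBall (q b t : ℕ) (x : List (Fin q)) : Set (List (Fin q)) :=
  {y | relIter (BurstDel b) t x y}

/-- The `b`-burst-insertion ball of radius `t` centered at `x`. -/
def insBall (q b t : ℕ) (x : List (Fin q)) : Set (List (Fin q)) :=
  {y | relIter (BurstIns b) t x y}

/-- The fixed-length `b`-burst Levenshtein ball of radius `t` centered at `x`:
`t` bursts of `b` deletions followed by `t` bursts of `b` insertions. -/
def levBall (q b t : ℕ) (x : List (Fin q)) : Set (List (Fin q)) :=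
  {z | ∃ y ∈ delBall q b t x, z ∈ insBall q b t y}

/-- `rB q b x` : the number of `b`-runs of `x` (0-indexed version of
`1 + |{i ∈ [1, n-b] : x_i ≠ x_{i+b}}|`). -/
def rB (q b : ℕ) (x : List (Fin q)) : ℕ :=
  1 + ((Finset.range (x.length - b)).filter fun i => x[i]? ≠ x[i + b]?).card

/-- `fB q b j x` : 0-indexed version of
`|{i ∈ [1, n-b-j] : x_i ≠ x_{i+b} ∧ x_{i+j} ≠ x_{i+j+b}}|`. -/
def fB (q b j : ℕ) (x : List (Fin q)) : ℕ :=
  ((Finset.range (x.length - b - j)).filter fun i =>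
    x[i]? ≠ x[i + b]? ∧ x[i + j]? ≠ x[i + j + b]?).card

/-- `gB q b i x` : 0-indexed version of
`|{j ∈ [i+b, n-b] : x_i ≠ x_{i+b}, x_j ≠ x_{j+b}, x_{[i,j+b]} is 2b-periodic}|`
(here `i` is a 0-based index, `i ∈ [0, n-2b-1]`). -/
def gB (q b i : ℕ) (x : List (Fin q)) : ℕ :=
  ((Finset.Icc (i + b) (x.length - b - 1)).filter fun j =>
    x[i]? ≠ x[i + b]? ∧ x[j]? ≠ x[j + b]? ∧
      ∀ t ∈ Finset.Icc i (j - b), x[t]? = x[t + 2 * b]?).card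

theorem burstDel_iff {q b : ℕ} {x y : List (Fin q)} :
    BurstDel b x y ↔ ∃ p u s, u.length = b ∧ x = p ++ (u ++ s) ∧ y = p ++ s := by
  constructor
  · rintro ⟨i, hi, rfl⟩
    refine ⟨x.take i, (x.drop i).take b, x.drop (i + b), by simp; omega, ?_, rfl⟩
    rw [← List.drop_drop, List.take_append_drop, List.take_append_drop]
  · rintro ⟨p, u, s, rfl, rfl, rfl⟩
    exact ⟨p.length, by simp, by simp [← List.drop_drop]⟩

theorem burstIns_iff_burstDel {q b : ℕ} {x y : List (Fin q)} :
    BurstIns b x y ↔ BurstDel b y x := by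
  rw [burstDel_iff]
  constructor
  · rintro ⟨i, v, hi, hv, rfl⟩
    exact ⟨x.take i, v, x.drop i, hv, by simp, by simp⟩
  · rintro ⟨p, v, s, hv, rfl, rfl⟩
    exact ⟨p.length, v, by simp, hv, by simp⟩

/-- Two words that differ only in a factor of length at most `b` have a common `b`-burst
subword. -/
theorem exists_common_burstDel {q b : ℕ} {p u v s : List (Fin q)} (huv : u.length = v.length)
    (hu : u.length ≤ b) (hb : b ≤ (p ++ (u ++ s)).length) :
    ∃ y, BurstDel b (p ++ (u ++ s)) y ∧ BurstDel b (p ++ (v ++ s)) y := by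
  simp only [List.length_append] at hb
  obtain ⟨i, hip, hib, hi⟩ : ∃ i, i ≤ p.length ∧ i + b ≤ p.length + (u.length + s.length) ∧
      p.length + u.length ≤ i + b :=
    ⟨min p.length (p.length + (u.length + s.length) - b), by omega, by omega, by omega⟩
  refine ⟨_, ⟨i, by simpa using hib, rfl⟩, ⟨i, by simpa [huv] using hib, ?_⟩⟩
  rw [List.take_append_of_le_length hip, List.take_append_of_le_length hip,
    ← List.append_assoc p u, ← List.append_assoc p v, List.drop_append (l₁ := p ++ u),
    List.drop_append (l₁ := p ++ v), List.drop_of_length_le (l := p ++ u) (by simpa using hi),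
    List.drop_of_length_le (l := p ++ v) (by simpa [← huv] using hi)]
  simp [huv]

/-- Two words with a common `b`-burst subword have a common `b`-burst superword. -/
theorem BurstDel.exists_common_superword {q b : ℕ} {x y z : List (Fin q)}
    (hx : BurstDel b x y) (hz : BurstDel b z y) :
    ∃ w, BurstDel b w x ∧ BurstDel b w z := by
  simp only [burstDel_iff] at *
  obtain ⟨p, u, s, hu, rfl, rfl⟩ := hx
  obtain ⟨p', v, s', hv, rfl, h⟩ := hz
  obtain ⟨m, rfl, rfl⟩ | ⟨m, rfl, rfl⟩ := List.append_eq_append_iff.1 h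
  · exact ⟨p ++ u ++ m ++ v ++ s', ⟨p ++ u ++ m, v, s', hv, by simp, by simp⟩,
      ⟨p, u, m ++ v ++ s', hu, by simp, by simp⟩⟩
  · exact ⟨p' ++ v ++ m ++ u ++ s, ⟨p', v, m ++ u ++ s, hv, by simp, by simp⟩,
      ⟨p' ++ v ++ m, u, s, hu, by simp, by simp⟩⟩

/-- Two words of length at least `b` with a common `b`-burst superword have a common `b`-burst
subword. -/
theorem BurstDel.exists_common_subword {q b : ℕ} {w x z : List (Fin q)}
    (hx : BurstDel b w x) (hz : BurstDel b w z) (hb : b ≤ x.length) :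
    ∃ y, BurstDel b x y ∧ BurstDel b z y := by
  wlog hle : ∃ p u s p' v s', p.length ≤ p'.length ∧ u.length = b ∧ v.length = b ∧
      w = p ++ (u ++ s) ∧ x = p ++ s ∧ w = p' ++ (v ++ s') ∧ z = p' ++ s' generalizing x z
  · obtain ⟨p, u, s, hu, hw, hxs⟩ := burstDel_iff.1 hx
    obtain ⟨p', v, s', hv, hw', hzs⟩ := burstDel_iff.1 hz
    have hlen : b ≤ z.length := by
      have := congrArg List.length (hw.symm.trans hw')
      simp only [hxs, hzs, List.length_append] at *
      omega
    obtain h | h := le_total p.length p'.length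
    · exact (hle ⟨p, u, s, p', v, s', h, hu, hv, hw, hxs, hw', hzs⟩).elim
    · obtain ⟨y, h₁, h₂⟩ := this hz hx hlen ⟨p', v, s', p, u, s, h, hv, hu, hw', hzs, hw, hxs⟩
      exact ⟨y, h₂, h₁⟩
  obtain ⟨p, u, s, p', v, s', hle, hu, hv, rfl, rfl, hw, rfl⟩ := hle
  obtain ⟨m, rfl, hm⟩ : ∃ m, p' = p ++ m ∧ u ++ s = m ++ (v ++ s') := by
    obtain h | ⟨m, rfl, hm⟩ := List.append_eq_append_iff.1 hw
    · exact h
    · obtain rfl : m = [] := List.length_eq_zero_iff.1 (by simp only [List.length_append] at hle; omega)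
      exact ⟨[], by simp, by simpa using hm.symm⟩
  obtain ⟨k, rfl, rfl⟩ | ⟨k, rfl, hk⟩ := List.append_eq_append_iff.1 hm
  · refine ⟨p ++ (k ++ s'), burstDel_iff.2 ⟨p ++ k, v, s', hv, by simp, by simp⟩,
      burstDel_iff.2 ⟨p, u, k ++ s', hu, by simp, by simp⟩⟩
  · obtain ⟨l, rfl, rfl⟩ | ⟨l, rfl, rfl⟩ := List.append_eq_append_iff.1 hk
    · simp only [List.length_append] at hu
      obtain rfl : m = [] := List.length_eq_zero_iff.1 (by omega)
      obtain rfl : l = [] := List.length_eq_zero_iff.1 (by omega)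
      simpa using exists_common_burstDel (u := []) (v := []) rfl (Nat.zero_le b) hb
    · simp only [List.length_append] at hu hv
      rw [List.append_assoc]
      exact exists_common_burstDel (by omega) (by omega) hb

/-- a burst of `b` deletions followed by a burst of `b` insertions
yields the same set of length-`n` sequences as a burst of `b` insertions followed
by a burst of `b` deletions. -/
theorem burst_del_ins_commute (q b n : ℕ) (hq : 2 ≤ q) (hb : 1 ≤ b) (hn : b + 1 ≤ n)
    (x : List (Fin q)) (hx : x.length = n) :
    {z : List (Fin q) | ∃ y ∈ delBall q b 1 x, z ∈ insBall q b 1 y} =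
      {z : List (Fin q) | ∃ w ∈ insBall q b 1 x, z ∈ delBall q b 1 w} := by
  have key : ∀ z, (∃ y, BurstDel b x y ∧ BurstDel b z y) ↔ ∃ w, BurstDel b w x ∧ BurstDel b w z :=
    fun z => ⟨fun ⟨_, h₁, h₂⟩ => h₁.exists_common_superword h₂,
      fun ⟨_, h₁, h₂⟩ => h₁.exists_common_subword h₂ (by omega)⟩
  ext z
  simpa [delBall, insBall, relIter, burstIns_iff_burstDel] using key z
end

section
/- Let q ≥ 2, b, t ≥ 1 and n ≥ bt+1. For every x ∈ Σ_q^n, the fixed-length b-burst Levenshtein ball of radius t satisfies |L_t^b(x)| ≥ q^{t(b−1)} · Σ_{i=0}^{t} C(n−t(b−1), i) (q−1)^i. -/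
/-- Every sequence in an insertion ball has the length prescribed by the insertions. -/
theorem length_of_mem_insBall {q b : ℕ} (t : ℕ) {x y : List (Fin q)}
    (h : y ∈ insBall q b t x) : y.length = x.length + t * b := by
  induction t generalizing x with
  | zero =>
    have h' : x = y := h
    simp [h']
  | succ t ih =>
    obtain ⟨z, ⟨i, v, hi, hv, rfl⟩, hz⟩ := h
    rw [ih hz]
    simp only [List.length_append, List.length_take, List.length_drop, hv, Nat.succ_mul]
    omega

theorem insBall_finite (q b t : ℕ) (x : List (Fin q)) : (insBall q b t x).Finite :=
  (List.finite_length_eq (Fin q) (x.length + t * b)).subset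
    fun _ h => length_of_mem_insBall t h

theorem cons_mem_insBall {q b : ℕ} (t : ℕ) (a : Fin q) {x y : List (Fin q)}
    (h : y ∈ insBall q b t x) : a :: y ∈ insBall q b t (a :: x) := by
  induction t generalizing x with
  | zero =>
    have h' : x = y := h
    exact congrArg (a :: ·) h'
  | succ t ih =>
    obtain ⟨z, ⟨i, v, hi, hv, rfl⟩, hz⟩ := h
    exact ⟨_, ⟨i + 1, v, by simpa using hi, hv, rfl⟩, ih hz⟩

theorem append_mem_insBall {q b : ℕ} (t : ℕ) (v : List (Fin q)) {x y : List (Fin q)}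
    (h : y ∈ insBall q b t x) : v ++ y ∈ insBall q b t (v ++ x) := by
  induction v with
  | nil => exact h
  | cons a v ih => exact cons_mem_insBall t a ih

theorem append_mem_insBall_succ {q b : ℕ} (t : ℕ) {v x y : List (Fin q)} (hv : v.length = b)
    (h : y ∈ insBall q b t x) : v ++ y ∈ insBall q b (t + 1) x :=
  ⟨v ++ x, ⟨0, v, Nat.zero_le _, hv, by simp⟩, append_mem_insBall t v h⟩

theorem mem_insBall_nil {q b : ℕ} (t : ℕ) {y : List (Fin q)} (h : y.length = t * b) :
    y ∈ insBall q b t [] := by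
  induction t generalizing y with
  | zero =>
    have h' : y = [] := by simpa using h
    exact h'.symm
  | succ t ih =>
    rw [Nat.succ_mul] at h
    rw [← List.take_append_drop b y]
    exact append_mem_insBall_succ t (by simp; omega) (ih (by simp; omega))

theorem ncard_length_eq (q k : ℕ) : {l : List (Fin q) | l.length = k}.ncard = q ^ k := by
  rw [← Nat.card_coe_set_eq]
  change Nat.card (List.Vector (Fin q) k) = _
  rw [Nat.card_eq_fintype_card, card_vector, Fintype.card_fin]

/-- Pascal-type recursion for the volume of a Hamming ball. -/
theorem sum_choose_succ_mul_pow (N t r : ℕ) :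
    ∑ i ∈ Finset.range (t + 2), (N + 1).choose i * r ^ i =
      ∑ i ∈ Finset.range (t + 2), N.choose i * r ^ i +
        r * ∑ i ∈ Finset.range (t + 1), N.choose i * r ^ i := by
  rw [Finset.sum_range_succ', Finset.sum_range_succ' (fun i => N.choose i * r ^ i) (t + 1),
    Finset.mul_sum]
  simp only [Nat.choose_succ_succ', add_mul, Finset.sum_add_distrib, Nat.choose_zero_right]
  have : ∀ i, N.choose i * r ^ (i + 1) = r * (N.choose i * r ^ i) := fun i => by ring
  simp only [this]
  ring

/-- Split of the insertion ball of `a :: x` according to whether the first letter is `a`. -/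
theorem insBall_cons_ncard_ge {q c : ℕ} (t : ℕ) (a : Fin q) (x : List (Fin q)) :
    (insBall q (c + 1) (t + 1) x).ncard +
        (q - 1) * (q ^ c * (insBall q (c + 1) t (a :: x)).ncard)
      ≤ (insBall q (c + 1) (t + 1) (a :: x)).ncard := by
  set P : Set (Fin q × List (Fin q) × List (Fin q)) :=
    {a}ᶜ ×ˢ {w : List (Fin q) | w.length = c} ×ˢ insBall q (c + 1) t (a :: x) with hP
  set f : Fin q × List (Fin q) × List (Fin q) → List (Fin q) :=
    fun p => p.1 :: (p.2.1 ++ p.2.2) with hf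
  have hA : ((a :: ·) '' insBall q (c + 1) (t + 1) x).ncard =
      (insBall q (c + 1) (t + 1) x).ncard :=
    Set.ncard_image_of_injective _ List.cons_injective
  have hB : (f '' P).ncard = (q - 1) * (q ^ c * (insBall q (c + 1) t (a :: x)).ncard) := by
    rw [Set.InjOn.ncard_image, hP, Set.ncard_prod, Set.ncard_prod, ncard_length_eq,
      Set.ncard_compl, Set.ncard_singleton, Nat.card_fin]
    rintro ⟨d, v, z⟩ ⟨-, hv, -⟩ ⟨d', v', z'⟩ ⟨-, hv', -⟩ h
    obtain ⟨h1, h2⟩ := List.cons.inj h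
    obtain ⟨h3, h4⟩ := List.append_inj h2 (Eq.trans hv (Eq.symm hv'))
    simp_all
  have hdisj : Disjoint ((a :: ·) '' insBall q (c + 1) (t + 1) x) (f '' P) := by
    rw [Set.disjoint_left]
    rintro _ ⟨y, -, rfl⟩ ⟨⟨d, v, z⟩, ⟨hd, -, -⟩, h⟩
    exact hd (List.cons.inj h).1
  have hfin := insBall_finite q (c + 1) (t + 1) (a :: x)
  have hAs : (a :: ·) '' insBall q (c + 1) (t + 1) x ⊆ insBall q (c + 1) (t + 1) (a :: x) := by
    rintro _ ⟨y, hy, rfl⟩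
    exact cons_mem_insBall _ a hy
  have hBs : f '' P ⊆ insBall q (c + 1) (t + 1) (a :: x) := by
    rintro _ ⟨⟨d, v, z⟩, ⟨-, hv, hz⟩, rfl⟩
    exact append_mem_insBall_succ t (v := d :: v) (congrArg (· + 1) hv) hz
  rw [← hA, ← hB, ← Set.ncard_union_eq hdisj (hfin.subset hAs) (hfin.subset hBs)]
  exact Set.ncard_le_ncard (Set.union_subset hAs hBs) hfin

theorem insBall_ncard_ge {q c : ℕ} (hq : 1 ≤ q) (t : ℕ) (x : List (Fin q)) :
    q ^ (t * c) * ∑ i ∈ Finset.range (t + 1), (x.length + t).choose i * (q - 1) ^ i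
      ≤ (insBall q (c + 1) t x).ncard := by
  induction t generalizing x with
  | zero =>
    have h : insBall q (c + 1) 0 x = {x} := Set.ext fun y => eq_comm
    simp [h]
  | succ t iht =>
    induction x with
    | nil =>
      have hsum : ∑ i ∈ Finset.range (t + 1 + 1), (t + 1).choose i * (q - 1) ^ i =
          q ^ (t + 1) := by
        have h := add_pow (q - 1) 1 (t + 1)
        rw [Nat.sub_add_cancel hq] at h
        rw [h]
        exact Finset.sum_congr rfl fun i _ => by simp [mul_comm]
      rw [List.length_nil, Nat.zero_add, hsum, ← pow_add, ← Nat.mul_succ, ← ncard_length_eq]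
      exact Set.ncard_le_ncard (fun y hy => mem_insBall_nil (t + 1) hy)
        (insBall_finite _ _ _ _)
    | cons a x ihx =>
      refine le_trans (le_of_eq ?_) (le_trans (Nat.add_le_add ihx
        (Nat.mul_le_mul_left (q - 1) (Nat.mul_le_mul_left (q ^ c) (iht (a :: x)))))
        (insBall_cons_ncard_ge t a x))
      have e : (a :: x).length + (t + 1) = (x.length + (t + 1)) + 1 := by
        simp only [List.length_cons]; omega
      have e' : (a :: x).length + t = x.length + (t + 1) := by
        simp only [List.length_cons]; omega
      rw [e, e', sum_choose_succ_mul_pow, Nat.succ_mul, pow_add]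
      ring

theorem exists_mem_delBall {q b : ℕ} (t : ℕ) (x : List (Fin q)) (h : t * b ≤ x.length) :
    ∃ y ∈ delBall q b t x, y.length = x.length - t * b := by
  induction t generalizing x with
  | zero => exact ⟨x, rfl, by simp⟩
  | succ t ih =>
    rw [Nat.succ_mul] at h ⊢
    obtain ⟨y, hy, hl⟩ := ih (x.drop b) (by rw [List.length_drop]; omega)
    refine ⟨y, ⟨_, ⟨0, by omega, by simp⟩, hy⟩, ?_⟩
    rw [hl, List.length_drop]
    omega

theorem levBall_finite {q b t : ℕ} (x : List (Fin q)) : (levBall q b t x).Finite := by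
  have hdel : ∀ s (x y : List (Fin q)), y ∈ delBall q b s x → y.length ≤ x.length := by
    intro s
    induction s with
    | zero => rintro x y (rfl : x = y); exact le_rfl
    | succ s ih =>
      rintro x y ⟨z, ⟨i, hi, rfl⟩, hz⟩
      refine (ih _ _ hz).trans ?_
      simp only [List.length_append, List.length_take, List.length_drop]
      omega
  refine (List.finite_length_le (Fin q) (x.length + t * b)).subset ?_
  rintro z ⟨y, hy, hz⟩
  have h1 := hdel t x y hy
  have h2 := length_of_mem_insBall t hz
  change z.length ≤ _
  omega


/-- lower bound on the size of the fixed-length `b`-burst Levenshtein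
ball of radius `t`. -/
theorem levBall_card_lower_bound (q b t n : ℕ) (hq : 2 ≤ q) (hb : 1 ≤ b) (ht : 1 ≤ t)
    (hn : b * t + 1 ≤ n) (x : List (Fin q)) (hx : x.length = n) :
    q ^ (t * (b - 1)) *
        ∑ i ∈ Finset.range (t + 1), (n - t * (b - 1)).choose i * (q - 1) ^ i
      ≤ (levBall q b t x).ncard := by
  obtain ⟨c, rfl⟩ : ∃ c, b = c + 1 := ⟨b - 1, by omega⟩
  have hle : t * (c + 1) ≤ x.length := by
    rw [mul_comm]; omega
  obtain ⟨y, hy, hl⟩ := exists_mem_delBall t x hle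
  have hlen : y.length + t = n - t * c := by
    rw [hl, hx, Nat.mul_succ]
    rw [hx, Nat.mul_succ] at hle
    omega
  have h := insBall_ncard_ge (c := c) (by omega : 1 ≤ q) t y
  rw [hlen] at h
  rw [Nat.add_sub_cancel]
  exact h.trans (Set.ncard_le_ncard (fun z hz => ⟨y, hy, hz⟩) (levBall_finite x))
end

section
/- Let q ≥ 2, b, t ≥ 1 and m ≥ 1. For any two distinct sequences y, y' ∈ Σ_q^m, there exists a sequence z ∈ I_t^b(y') such that z ∉ I_t^b(y); in particular, the b-burst-insertion balls of radius t centered at distinct sequences never contain one another. (Explicitly, if j is the first position where y and y' differ, then z = y'_{[1,j−1]} (y'_j 0^{b−1})^t y'_{[j,m]} is such a sequence.) -/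
/-- Each entry of `y` survives in any `z ∈ I_t^b(y)`, shifted by a multiple of `b`
of size at most `t * b`. -/
theorem exists_getElem?_eq_of_mem_insBall {q b t : ℕ} {y z : List (Fin q)}
    (h : z ∈ insBall q b t y) {i : ℕ} (hi : i < y.length) :
    ∃ k ≤ t, z[i + k * b]? = y[i]? := by
  induction t generalizing y i with
  | zero =>
    obtain rfl : y = z := h
    exact ⟨0, le_rfl, by simp⟩
  | succ t ih =>
    obtain ⟨x, ⟨p, v, hp, hv, rfl⟩, hz⟩ := h
    rcases lt_or_ge i p with hip | hip
    · obtain ⟨k, hk, hzk⟩ := ih hz (i := i) (by simp; omega)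
      refine ⟨k, by omega, hzk.trans ?_⟩
      rw [List.append_assoc, List.getElem?_append_left (by simp; omega),
        List.getElem?_take_of_lt hip]
    · obtain ⟨k, hk, hzk⟩ := ih hz (i := i + b) (by simp; omega)
      refine ⟨k + 1, by omega, ?_⟩
      rw [show i + (k + 1) * b = i + b + k * b by ring, hzk,
        List.getElem?_append_right (by simp; omega), List.getElem?_drop]
      congr 1
      simp
      omega

/-- Inserting a constant block of length `t * b` is achieved by `t` bursts of `b` insertions. -/
theorem append_replicate_append_mem_insBall {q : ℕ} (b t : ℕ) (c : Fin q) (l r : List (Fin q)) :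
    l ++ (List.replicate (t * b) c ++ r) ∈ insBall q b t (l ++ r) := by
  induction t generalizing r with
  | zero => simp [insBall, relIter]
  | succ t ih =>
    refine ⟨l ++ (List.replicate b c ++ r),
      ⟨l.length, List.replicate b c, by simp, by simp, by simp⟩, ?_⟩
    have h := ih (List.replicate b c ++ r)
    rwa [← List.append_assoc (List.replicate (t * b) c), List.replicate_append_replicate,
      ← Nat.succ_mul] at h

/-- burst-insertion balls of radius `t` centered at distinct sequences
never contain one another: there is a sequence in `I_t^b(y')` that is not in `I_t^b(y)`. -/
theorem insBall_not_subset (q b t m : ℕ) (hq : 2 ≤ q) (hb : 1 ≤ b) (ht : 1 ≤ t)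
    (hm : 1 ≤ m) (y y' : List (Fin q)) (hy : y.length = m) (hy' : y'.length = m)
    (hne : y ≠ y') :
    ∃ z ∈ insBall q b t y', z ∉ insBall q b t y := by
  obtain ⟨j, hj⟩ : ∃ j, y[j]? ≠ y'[j]? := by
    by_contra! h
    exact hne (List.ext_getElem? h)
  have hjm : j < m := by
    by_contra! h
    exact hj (by rw [List.getElem?_eq_none (by omega), List.getElem?_eq_none (by omega)])
  have hj' : j < y'.length := by omega
  have hmem := append_replicate_append_mem_insBall b t y'[j] (y'.take j) (y'.drop j)
  rw [List.take_append_drop] at hmem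
  refine ⟨_, hmem, fun h => ?_⟩
  obtain ⟨k, hk, hzk⟩ := exists_getElem?_eq_of_mem_insBall h (i := j) (by omega)
  apply hj
  have hlen : (y'.take j).length = j := by simp; omega
  rw [← hzk, List.getElem?_append_right (by omega), hlen, Nat.add_sub_cancel_left]
  rcases hk.lt_or_eq with hlt | rfl
  · have hkb : k * b < t * b := Nat.mul_lt_mul_of_pos_right hlt hb
    rw [List.getElem?_append_left (by simpa using hkb), List.getElem?_replicate_of_lt hkb,
      List.getElem?_eq_getElem hj']
  · rw [List.getElem?_append_right (by simp)]
    simp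
end

section
/- Let q ≥ 2, b ≥ 2 and n ≥ 2b+1. For every x ∈ Σ_q^n, |L_1^b(x)| ≤ q^{b−1}(n−b+1)((n−b+1)(q−1)+1). -/
lemma burstIns_cons {q k : ℕ} {a : Fin q} {y z : List (Fin q)}
    (h : BurstIns (k + 1) (a :: y) z) :
    (∃ w, BurstIns (k + 1) y w ∧ z = a :: w) ∨
      ∃ c v, c ≠ a ∧ v.length = k ∧ z = c :: (v ++ a :: y) := by
  obtain ⟨i, v, hi, hv, rfl⟩ := h
  cases i with
  | zero =>
    obtain ⟨c, v, rfl⟩ := List.exists_cons_of_length_eq_add_one hv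
    by_cases hc : c = a
    · subst hc
      exact Or.inl ⟨v ++ [c] ++ y, ⟨0, v ++ [c], by simp, by simpa using hv, by simp⟩, by simp⟩
    · exact Or.inr ⟨c, v, hc, by simpa using hv, by simp⟩
  | succ i =>
    exact Or.inl ⟨y.take i ++ v ++ y.drop i, ⟨i, v, by simpa using hi, hv, rfl⟩, by simp⟩

lemma exists_finset_burstIns (q k : ℕ) (y : List (Fin q)) :
    ∃ S : Finset (List (Fin q)), (∀ z, BurstIns (k + 1) y z → z ∈ S) ∧
      S.card ≤ q ^ (k + 1) + y.length * ((q - 1) * q ^ k) := by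
  induction y with
  | nil =>
    refine ⟨Finset.univ.image (List.ofFn : (Fin (k + 1) → Fin q) → _), ?_, ?_⟩
    · rintro z ⟨i, v, -, hv, rfl⟩
      simp only [List.take_nil, List.drop_nil, List.nil_append, List.append_nil,
        Finset.mem_image, Finset.mem_univ, true_and]
      rw [← hv]
      exact ⟨v.get, List.ofFn_get v⟩
    · refine Finset.card_image_le.trans ?_
      simp
  | cons a y ih =>
    obtain ⟨S, hS, hcard⟩ := ih
    refine ⟨S.image (List.cons a) ∪
      ((Finset.univ.erase a) ×ˢ (Finset.univ : Finset (Fin k → Fin q))).image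
        (fun p => p.1 :: (List.ofFn p.2 ++ a :: y)), ?_, ?_⟩
    · intro z hz
      rw [Finset.mem_union]
      rcases burstIns_cons hz with ⟨w, hw, rfl⟩ | ⟨c, v, hc, rfl, rfl⟩
      · exact Or.inl (Finset.mem_image_of_mem _ (hS w hw))
      · exact Or.inr (Finset.mem_image.2 ⟨(c, v.get), by simp [hc], by simp⟩)
    · refine (Finset.card_union_le _ _).trans
        ((add_le_add Finset.card_image_le Finset.card_image_le).trans ?_)
      simp only [Finset.card_product, Finset.mem_univ, Finset.card_erase_of_mem,
        Finset.card_univ, Fintype.card_fin, Fintype.card_fun, List.length_cons]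
      linarith

/-- general upper bound on the size of the fixed-length `b`-burst
Levenshtein ball of radius one. -/
theorem levBall_card_upper_bound (q b n : ℕ) (hq : 2 ≤ q) (hb : 2 ≤ b)
    (hn : 2 * b + 1 ≤ n) (x : List (Fin q)) (hx : x.length = n) :
    (levBall q b 1 x).ncard ≤
      q ^ (b - 1) * (n - b + 1) * ((n - b + 1) * (q - 1) + 1) := by
  classical
  obtain ⟨k, rfl⟩ : ∃ k, b = k + 1 := ⟨b - 1, by omega⟩
  choose S hS hcard using exists_finset_burstIns q k
  set del : ℕ → List (Fin q) := fun i => x.take i ++ x.drop (i + (k + 1)) with hdel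
  have hsub : levBall q (k + 1) 1 x ⊆
      ((Finset.range (n - (k + 1) + 1)).biUnion fun i => S (del i) : Finset _) := by
    rintro z ⟨y, ⟨_, ⟨i, hi, rfl⟩, rfl⟩, ⟨_, hz, rfl⟩⟩
    rw [Finset.mem_coe, Finset.mem_biUnion]
    exact ⟨i, Finset.mem_range.2 (by omega), hS _ _ hz⟩
  have hle := Set.ncard_le_ncard hsub (Finset.finite_toSet _)
  rw [Set.ncard_coe_finset] at hle
  refine hle.trans ((Finset.card_biUnion_le_card_mul _ _
    (q ^ k * ((n - (k + 1) + 1) * (q - 1) + 1)) ?_).trans (le_of_eq ?_))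
  · intro i hi
    have hi := Finset.mem_range.1 hi
    have hlen : (del i).length = n - (k + 1) := by
      simp only [hdel, List.length_append, List.length_take, List.length_drop]
      omega
    refine (hcard _).trans (le_of_eq ?_)
    rw [hlen]
    obtain ⟨p, rfl⟩ : ∃ p, q = p + 1 := ⟨q - 1, by omega⟩
    simp only [Nat.add_sub_cancel]
    ring
  · rw [Finset.card_range, Nat.add_sub_cancel]
    ring
end

section
/- Let q ≥ 3, b ≥ 2 and n ≥ 2b+1, and set M = q^{b−1}(n−b+1)((n−b+1)(q−1)−1) + 2q^{b−1} − (n−b)(q^{b−1}−1)/(q−1) + (q^b − q − (b−1)(q−1))/(q−1)^2. Then |L_1^b(x)| ≤ M for every x ∈ Σ_q^n, and equality |L_1^b(x)| = M holds whenever x satisfies x_i ≠ x_{i+b} for all i ∈ [1, n−b] and x_i ≠ x_{i+2b} for all i ∈ [1, n−2b]. -/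
open Finset

section BurstBall

variable {q n b : ℕ}

/-- Extend `z : Fin n → Fin q` to all of `ℕ` by the values of `X`. -/
def extendBy (X : ℕ → Fin q) (z : Fin n → Fin q) (i : ℕ) : Fin q :=
  if h : i < n then z ⟨i, h⟩ else X i

/-- The sequences of length `n` whose `i`-th entry lies in `S i`. -/
def entryBox (n : ℕ) (S : ℕ → Finset (Fin q)) : Finset (Fin n → Fin q) :=
  Fintype.piFinset fun i => S i

lemma mem_entryBox (X : ℕ → Fin q) (S : ℕ → Finset (Fin q)) (z : Fin n → Fin q) :
    z ∈ entryBox n S ↔ ∀ i < n, extendBy X z i ∈ S i := by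
  simp only [entryBox, Fintype.mem_piFinset, extendBy]
  constructor
  · intro h i hi
    simpa [hi] using h ⟨i, hi⟩
  · intro h i
    simpa using h i i.2

lemma card_entryBox (S : ℕ → Finset (Fin q)) : (entryBox n S).card = ∏ i ∈ range n, (S i).card := by
  rw [entryBox, Fintype.card_piFinset, Finset.prod_range]

lemma entryBox_inter (S T : ℕ → Finset (Fin q)) :
    entryBox n S ∩ entryBox n T = entryBox n fun i => S i ∩ T i := by
  ext z
  simp [entryBox, Fintype.mem_piFinset, forall_and]

/-- Entry constraints: the last change is at `s`, all changes lie in a window of length `b`. -/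
def shortBox (b : ℕ) (X : ℕ → Fin q) (s i : ℕ) : Finset (Fin q) :=
  if i = s then {X i}ᶜ else if i < s ∧ s < i + b then univ else {X i}

/-- Entry constraints: the changes span `[p, u + b]`, and `[p, u]` is shifted right by `b`. -/
def rightBox (b : ℕ) (X : ℕ → Fin q) (p u i : ℕ) : Finset (Fin q) :=
  if i < p ∨ u + b < i then {X i} else if i = p then {X p}ᶜ else if i < p + b then univ
  else if i = u + b then {X u} \ {X (u + b)} else {X (i - b)}

/-- Entry constraints: the changes span `[p, u + b]`, and `[p + b, u + b]` is shifted left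
by `b`. -/
def leftBox (b : ℕ) (X : ℕ → Fin q) (p u i : ℕ) : Finset (Fin q) :=
  if i < p ∨ u + b < i then {X i} else if i = p then {X (p + b)} \ {X p}
  else if i ≤ u then {X (i + b)} else if i = u + b then {X i}ᶜ else univ

/-- `Z` and `X` become equal after one burst of `b` deletions in each. -/
def CommonDel (n b : ℕ) (X Z : ℕ → Fin q) : Prop :=
  ∃ i j, i + b ≤ n ∧ j + b ≤ n ∧
    ∀ t, t + b < n → (if t < j then Z t else Z (t + b)) = if t < i then X t else X (t + b)

lemma commonDel_of_short (hb : 0 < b) (hn : b ≤ n) {X Z : ℕ → Fin q} {s : ℕ} (hs : s < n)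
    (h : ∀ i < n, Z i ∈ shortBox b X s i) : CommonDel n b X Z := by
  refine ⟨s + 1 - b, s + 1 - b, by omega, by omega, fun t ht => ?_⟩
  have h1 := h t (by omega)
  have h2 := h (t + b) (by omega)
  unfold shortBox at h1 h2
  split_ifs with ht'
  · rw [if_neg (by omega), if_neg (by omega)] at h1
    simpa using h1
  · rw [if_neg (by omega), if_neg (by omega)] at h2
    simpa using h2

lemma commonDel_of_right (hb : 0 < b) {X Z : ℕ → Fin q} {p u : ℕ} (hpu : p ≤ u)
    (hu : u + b < n) (h : ∀ i < n, Z i ∈ rightBox b X p u i) : CommonDel n b X Z := by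
  refine ⟨u + 1, p, by omega, by omega, fun t ht => ?_⟩
  have h1 := h t (by omega)
  have h2 := h (t + b) (by omega)
  unfold rightBox at h1 h2
  grind

lemma commonDel_of_left (hb : 0 < b) {X Z : ℕ → Fin q} {p u : ℕ} (hpu : p ≤ u)
    (hu : u + b < n) (h : ∀ i < n, Z i ∈ leftBox b X p u i) : CommonDel n b X Z := by
  refine ⟨p, u + 1, by omega, by omega, fun t ht => ?_⟩
  have h1 := h t (by omega)
  have h2 := h (t + b) (by omega)
  unfold leftBox at h1 h2
  grind

lemma exists_first_last_ne {X Z : ℕ → Fin q} (h : ∃ i < n, Z i ≠ X i) :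
    ∃ p s, p ≤ s ∧ s < n ∧ Z p ≠ X p ∧ Z s ≠ X s ∧ (∀ i < p, Z i = X i) ∧
      ∀ i < n, s < i → Z i = X i := by
  classical
  have hne : ((range n).filter fun i => Z i ≠ X i).Nonempty := by
    obtain ⟨i, hi⟩ := h
    exact ⟨i, by simpa using hi⟩
  have hp := min'_mem _ hne
  have hs := max'_mem _ hne
  obtain ⟨hpn, hZp⟩ := mem_filter.1 hp
  obtain ⟨hsn, hZs⟩ := mem_filter.1 hs
  rw [mem_range] at hpn hsn
  refine ⟨_, _, min'_le _ _ hs, hsn, hZp, hZs, fun i hi => ?_, fun i hin hi => ?_⟩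
  · by_contra hc
    have := min'_le ((range n).filter fun i => Z i ≠ X i) i
      (mem_filter.2 ⟨mem_range.2 (hi.trans hpn), hc⟩)
    exact absurd hi this.not_gt
  · by_contra hc
    have := le_max' ((range n).filter fun i => Z i ≠ X i) i
      (mem_filter.2 ⟨mem_range.2 hin, hc⟩)
    exact absurd hi this.not_gt

lemma CommonDel.cases {X Z : ℕ → Fin q} (h : CommonDel n b X Z) :
    (∀ i < n, Z i = X i) ∨ (∃ s < n, ∀ i < n, Z i ∈ shortBox b X s i) ∨
      ∃ u p, u + b < n ∧ p ≤ u ∧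
        ((∀ i < n, Z i ∈ rightBox b X p u i) ∨ ∀ i < n, Z i ∈ leftBox b X p u i) := by
  by_cases hZ : ∀ i < n, Z i = X i
  · exact Or.inl hZ
  push Not at hZ
  obtain ⟨p, s, hps, hs, hZp, hZs, hlt, hgt⟩ := exists_first_last_ne hZ
  refine Or.inr ?_
  rcases lt_or_ge s (p + b) with hsp | hsp
  · refine Or.inl ⟨s, hs, fun i hi => ?_⟩
    have h1 := hlt i
    have h2 := hgt i hi
    unfold shortBox
    split_ifs with h3 h4
    · simpa [h3] using hZs
    · simp
    · rw [mem_singleton]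
      rcases lt_or_ge s i with h5 | h5
      · exact h2 h5
      · exact h1 (by omega)
  obtain ⟨u, rfl⟩ : ∃ u, s = u + b := ⟨s - b, by omega⟩
  refine Or.inr ⟨u, p, hs, by omega, ?_⟩
  obtain ⟨i, j, hi, hj, hD⟩ := h
  have hDp := hD p (by omega)
  have hDu := hD u hs
  rcases le_total j i with hji | hij
  · have h1 : j ≤ p := by
      by_contra hc
      rw [if_pos (by omega), if_pos (by omega)] at hDp
      exact hZp hDp
    have h2 : u < i := by
      by_contra hc
      rw [if_neg (by omega), if_neg (by omega)] at hDu
      exact hZs hDu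
    refine Or.inl fun k hk => ?_
    have h3 := hlt k
    have h4 := hgt k hk
    unfold rightBox
    split_ifs with h5 h6 h7 h8
    · rw [mem_singleton]
      exact h5.elim h3 h4
    · simpa [h6] using hZp
    · exact mem_univ _
    · subst h8
      rw [if_neg (by omega), if_pos (by omega)] at hDu
      simpa [hDu] using hDu ▸ hZs
    · have h9 := hD (k - b) (by omega)
      rw [if_neg (by omega), if_pos (by omega), Nat.sub_add_cancel (by omega)] at h9
      simpa using h9
  · have h1 : i ≤ p := by
      by_contra hc
      rw [if_pos (by omega), if_pos (by omega)] at hDp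
      exact hZp hDp
    have h2 : u < j := by
      by_contra hc
      rw [if_neg (by omega), if_neg (by omega)] at hDu
      exact hZs hDu
    refine Or.inr fun k hk => ?_
    have h3 := hlt k
    have h4 := hgt k hk
    unfold leftBox
    split_ifs with h5 h6 h7 h8
    · rw [mem_singleton]
      exact h5.elim h3 h4
    · subst h6
      rw [if_pos (by omega), if_neg (by omega)] at hDp
      simpa [hDp] using hDp ▸ hZp
    · have h9 := hD k (by omega)
      rw [if_pos (by omega), if_neg (by omega)] at h9
      simpa using h9
    · simpa [h8] using hZs
    · exact mem_univ _

/-- The Levenshtein ball, split according to the positions of the first and last change. -/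
def ballFinset (n b : ℕ) (X : ℕ → Fin q) : Finset (Fin n → Fin q) :=
  (entryBox n fun i => {X i}) ∪ ((range n).biUnion fun s => entryBox n (shortBox b X s)) ∪
    ((range (n - b)).sigma fun u => range (u + 1)).biUnion fun r =>
      entryBox n (rightBox b X r.2 r.1) ∪ entryBox n (leftBox b X r.2 r.1)

lemma mem_ballFinset (hb : 0 < b) (hn : b ≤ n) (X : ℕ → Fin q) (z : Fin n → Fin q) :
    z ∈ ballFinset n b X ↔ CommonDel n b X (extendBy X z) := by
  simp only [ballFinset, mem_union, mem_biUnion, mem_range, mem_sigma, mem_entryBox X,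
    mem_singleton, Sigma.exists]
  constructor
  · rintro ((h | ⟨s, hs, h⟩) | ⟨u, p, ⟨hu, hp⟩, h | h⟩)
    · exact ⟨0, 0, by omega, by omega, fun t ht => by simpa using h _ ht⟩
    · exact commonDel_of_short hb hn hs h
    · exact commonDel_of_right hb (by omega) (by omega) h
    · exact commonDel_of_left hb (by omega) (by omega) h
  · intro h
    rcases h.cases with h | h | ⟨u, p, hu, hp, h⟩
    · exact Or.inl (Or.inl h)
    · exact Or.inl (Or.inr h)
    · exact Or.inr ⟨u, p, ⟨by omega, by omega⟩, h⟩

lemma short_spec (hb : 0 < b) {X Z : ℕ → Fin q} {s : ℕ} (hs : s < n)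
    (h : ∀ i < n, Z i ∈ shortBox b X s i) :
    Z s ≠ X s ∧ (∀ i < n, s < i → Z i = X i) ∧ ∀ i, i + b ≤ s → Z i = X i := by
  refine ⟨?_, fun i hi hsi => ?_, fun i hi => ?_⟩
  · have := h s hs
    simpa [shortBox] using this
  · have := h i hi
    unfold shortBox at this
    grind [mem_compl]
  · have := h i (by omega)
    unfold shortBox at this
    grind [mem_compl]

lemma long_spec (hb : 0 < b) {X Z : ℕ → Fin q} {p u : ℕ} (hpu : p ≤ u) (hu : u + b < n)
    (h : (∀ i < n, Z i ∈ rightBox b X p u i) ∨ ∀ i < n, Z i ∈ leftBox b X p u i) :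
    Z (u + b) ≠ X (u + b) ∧ (∀ i < n, u + b < i → Z i = X i) ∧ Z p ≠ X p ∧
      ∀ i < p, Z i = X i := by
  rcases h with h | h
  · refine ⟨?_, fun i hi hsi => ?_, ?_, fun i hi => ?_⟩
    · have := h (u + b) hu
      unfold rightBox at this
      grind [mem_compl]
    · have := h i hi
      unfold rightBox at this
      grind [mem_compl]
    · have := h p (by omega)
      unfold rightBox at this
      grind [mem_compl]
    · have := h i (by omega)
      unfold rightBox at this
      grind [mem_compl]
  · refine ⟨?_, fun i hi hsi => ?_, ?_, fun i hi => ?_⟩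
    · have := h (u + b) hu
      unfold leftBox at this
      grind [mem_compl]
    · have := h i hi
      unfold leftBox at this
      grind [mem_compl]
    · have := h p (by omega)
      unfold leftBox at this
      grind [mem_compl]
    · have := h i (by omega)
      unfold leftBox at this
      grind [mem_compl]

lemma card_ballFinset (hb : 0 < b) (X : ℕ → Fin q) :
    (ballFinset n b X).card = 1 + ∑ s ∈ range n, (entryBox n (shortBox b X s)).card +
      ∑ u ∈ range (n - b), ∑ p ∈ range (u + 1),
        (entryBox n (rightBox b X p u) ∪ entryBox n (leftBox b X p u)).card := by
  rw [ballFinset, card_union_of_disjoint, card_union_of_disjoint, card_biUnion, card_biUnion,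
    sum_sigma, card_entryBox]
  · simp
  · rintro ⟨u, p⟩ h ⟨u', p'⟩ h' hne
    simp only [coe_sigma, Set.mem_sigma_iff, mem_coe, mem_range] at h h'
    change Disjoint _ _
    rw [disjoint_left]
    intro z hz hz'
    simp only [mem_union, mem_entryBox X] at hz hz'
    obtain ⟨a1, a2, a3, a4⟩ := long_spec hb (by omega) (by omega) hz
    obtain ⟨c1, c2, c3, c4⟩ := long_spec hb (by omega) (by omega) hz'
    have hu : u = u' := by
      rcases lt_trichotomy u u' with hlt | heq | hlt
      · exact absurd (a2 (u' + b) (by omega) (by omega)) c1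
      · exact heq
      · exact absurd (c2 (u + b) (by omega) (by omega)) a1
    have hp : p = p' := by
      rcases lt_trichotomy p p' with hlt | heq | hlt
      · exact absurd (c4 p hlt) a3
      · exact heq
      · exact absurd (a4 p' hlt) c3
    subst hu hp
    exact hne rfl
  · intro s hs s' hs' hne
    simp only [mem_coe, mem_range] at hs hs'
    change Disjoint _ _
    rw [disjoint_left]
    intro z hz hz'
    simp only [mem_entryBox X] at hz hz'
    obtain ⟨a1, a2, -⟩ := short_spec hb hs hz
    obtain ⟨c1, c2, -⟩ := short_spec hb hs' hz'
    rcases lt_or_gt_of_ne hne with hlt | hlt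
    · exact c1 (a2 s' hs' hlt)
    · exact a1 (c2 s hs hlt)
  · rw [disjoint_left]
    intro z hz hz'
    simp only [mem_biUnion, mem_range, mem_entryBox X, mem_singleton] at hz hz'
    obtain ⟨s, hs, h⟩ := hz'
    exact (short_spec hb hs h).1 (hz s hs)
  · rw [disjoint_left]
    intro z hz hz'
    simp only [mem_union, mem_biUnion, mem_range, mem_sigma, mem_entryBox X, mem_singleton,
      Sigma.exists] at hz hz'
    obtain ⟨u, p, ⟨hu, hp⟩, h⟩ := hz'
    obtain ⟨a1, a2, a3, -⟩ := long_spec hb (by omega) (by omega) h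
    rcases hz with hz | ⟨s, hs, hz⟩
    · exact a3 (hz p (by omega))
    · obtain ⟨c1, c2, c3⟩ := short_spec hb hs hz
      rcases lt_trichotomy s (u + b) with hlt | rfl | hlt
      · exact a1 (c2 _ (by omega) hlt)
      · exact a3 (c3 p (by omega))
      · exact c1 (a2 s hs hlt)

lemma prod_range_ite_Ico {c d : ℕ} (hd : d ≤ n) (a : ℕ) :
    ∏ i ∈ range n, (if c ≤ i ∧ i < d then a else 1) = a ^ (d - c) := by
  rw [prod_ite, prod_const, prod_const_one, mul_one]
  congr 1
  rw [← Nat.card_Ico]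
  congr 1
  ext i
  simp only [mem_filter, mem_range, mem_Ico]
  omega

lemma card_shortBox (hb : 0 < b) (X : ℕ → Fin q) {s : ℕ} (hs : s < n) :
    (entryBox n (shortBox b X s)).card = (q - 1) * q ^ min s (b - 1) := by
  have : ∀ i ∈ range n, (shortBox b X s i).card =
      (if i = s then q - 1 else 1) * if s + 1 - b ≤ i ∧ i < s then q else 1 := by
    intro i hi
    unfold shortBox
    split_ifs <;> first | omega | simp [card_compl]
  rw [card_entryBox, prod_congr rfl this, prod_mul_distrib, prod_range_ite_Ico hs.le,
    prod_ite_eq', if_pos (by simpa using hs)]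
  congr 2
  omega

lemma card_rightBox (hb : 0 < b) (X : ℕ → Fin q) {p u : ℕ} (hpu : p ≤ u) (hu : u + b < n) :
    (entryBox n (rightBox b X p u)).card = if X u = X (u + b) then 0 else (q - 1) * q ^ (b - 1) := by
  rw [card_entryBox]
  split_ifs with hX
  · refine prod_eq_zero (i := u + b) (by simpa using hu) ?_
    simp [rightBox, hX, show ¬ u + b < p by omega, show ¬ u + b = p by omega,
      show ¬ u < p by omega]
  · have : ∀ i ∈ range n, (rightBox b X p u i).card =
        (if i = p then q - 1 else 1) * if p + 1 ≤ i ∧ i < p + b then q else 1 := by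
      intro i hi
      unfold rightBox
      split_ifs <;> first | omega | simp [card_compl]
      all_goals rw [sdiff_eq_self_of_disjoint (by simpa using hX)]; simp
    rw [prod_congr rfl this, prod_mul_distrib, prod_range_ite_Ico (by omega),
      prod_ite_eq', if_pos (by simp; omega)]
    congr 2
    omega

lemma card_leftBox (hb : 0 < b) (X : ℕ → Fin q) {p u : ℕ} (hpu : p ≤ u) (hu : u + b < n) :
    (entryBox n (leftBox b X p u)).card = if X p = X (p + b) then 0 else (q - 1) * q ^ (b - 1) := by
  rw [card_entryBox]
  split_ifs with hX
  · refine prod_eq_zero (i := p) (by simp; omega) ?_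
    simp [leftBox, hX, show ¬ u + b < p by omega]
  · have : ∀ i ∈ range n, (leftBox b X p u i).card =
        (if i = u + b then q - 1 else 1) * if u + 1 ≤ i ∧ i < u + b then q else 1 := by
      intro i hi
      unfold leftBox
      split_ifs <;> first | omega | simp [card_compl]
      all_goals rw [sdiff_eq_self_of_disjoint (by simpa using Ne.symm hX)]; simp
    rw [prod_congr rfl this, prod_mul_distrib, prod_range_ite_Ico (by omega),
      prod_ite_eq', if_pos (by simp; omega)]
    congr 2
    omega

/-- The least possible size of the intersection of two nonempty boxes `rightBox b X p (p + d)` and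
`leftBox b X p (p + d)`. -/
def overlap (q b d : ℕ) : ℕ := if d < b then q ^ (b - 1 - d) else 0

lemma card_right_inter_left_of_lt (X : ℕ → Fin q) {p u : ℕ} (hpu : p ≤ u)
    (hu : u + b < n) (hup : u < p + b) (h1 : X p ≠ X (p + b)) (h2 : X u ≠ X (u + b)) :
    (entryBox n (rightBox b X p u) ∩ entryBox n (leftBox b X p u)).card = q ^ (b - 1 - (u - p)) := by
  rw [entryBox_inter, card_entryBox]
  have : ∀ i ∈ range n, (rightBox b X p u i ∩ leftBox b X p u i).card =
      if u + 1 ≤ i ∧ i < p + b then q else 1 := by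
    intro i hi
    unfold rightBox leftBox
    by_cases hi1 : i < p ∨ u + b < i
    · simp only [if_pos hi1, inter_self, card_singleton]
      rw [if_neg (by omega)]
    rw [if_neg hi1, if_neg hi1]
    by_cases hi2 : i = p
    · subst hi2
      rw [if_pos rfl, if_pos rfl, if_neg (by omega), card_eq_one]
      exact ⟨X (i + b), by ext a; simp; grind⟩
    rw [if_neg hi2, if_neg hi2]
    by_cases hi3 : i < p + b
    · rw [if_pos hi3, univ_inter, if_neg (by omega : ¬ i = u + b)]
      split_ifs <;> first | omega | simp
    rw [if_neg hi3, if_neg (by omega : ¬ i ≤ u), if_neg (by omega : ¬ (u + 1 ≤ i ∧ i < p + b)),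
      card_eq_one]
    by_cases hi4 : i = u + b
    · subst hi4
      rw [if_pos rfl, if_pos rfl]
      exact ⟨X u, by ext a; simp; grind⟩
    · rw [if_neg hi4, if_neg hi4]
      exact ⟨X (i - b), by simp⟩
  rw [prod_congr rfl this, prod_range_ite_Ico (by omega)]
  congr 1
  omega

lemma card_right_inter_left_of_ge (hb : 0 < b) (X : ℕ → Fin q) {p u : ℕ} (hu : u + b < n)
    (hup : p + b ≤ u) (h : X p ≠ X (p + 2 * b)) :
    (entryBox n (rightBox b X p u) ∩ entryBox n (leftBox b X p u)).card = 0 := by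
  rw [entryBox_inter, card_entryBox]
  refine prod_eq_zero (i := p + b) (by simp; omega) ?_
  rw [card_eq_zero]
  ext a
  simp only [rightBox, leftBox, mem_inter, notMem_empty, iff_false]
  have : p + b + b = p + 2 * b := by omega
  grind

lemma card_union_add_overlap_le (hq : 2 ≤ q) (hb : 0 < b) (X : ℕ → Fin q) {p u : ℕ}
    (hpu : p ≤ u) (hu : u + b < n) :
    (entryBox n (rightBox b X p u) ∪ entryBox n (leftBox b X p u)).card + overlap q b (u - p) ≤
      2 * ((q - 1) * q ^ (b - 1)) := by
  have hR := card_rightBox hb X hpu hu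
  have hL := card_leftBox hb X hpu hu
  have hU := card_union_add_card_inter (entryBox n (rightBox b X p u)) (entryBox n (leftBox b X p u))
  have hE : overlap q b (u - p) ≤ (q - 1) * q ^ (b - 1) := by
    unfold overlap
    split_ifs
    · calc q ^ (b - 1 - (u - p)) ≤ q ^ (b - 1) := Nat.pow_le_pow_right (by omega) (by omega)
        _ ≤ (q - 1) * q ^ (b - 1) := Nat.le_mul_of_pos_left _ (by omega)
    · exact Nat.zero_le _
  by_cases h1 : X p = X (p + b)
  · rw [if_pos h1] at hL
    split_ifs at hR <;> omega
  rw [if_neg h1] at hL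
  by_cases h2 : X u = X (u + b)
  · rw [if_pos h2] at hR
    omega
  rw [if_neg h2] at hR
  by_cases h3 : u < p + b
  · have hI := card_right_inter_left_of_lt X hpu hu h3 h1 h2
    rw [overlap, if_pos (by omega)]
    omega
  · rw [overlap, if_neg (by omega)]
    omega

lemma card_union_add_overlap_eq (hb : 0 < b) (X : ℕ → Fin q) {p u : ℕ}
    (hpu : p ≤ u) (hu : u + b < n) (h1 : ∀ i, i + b < n → X i ≠ X (i + b))
    (h2 : ∀ i, i + 2 * b < n → X i ≠ X (i + 2 * b)) :
    (entryBox n (rightBox b X p u) ∪ entryBox n (leftBox b X p u)).card + overlap q b (u - p) =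
      2 * ((q - 1) * q ^ (b - 1)) := by
  have hR := card_rightBox hb X hpu hu
  have hL := card_leftBox hb X hpu hu
  have hU := card_union_add_card_inter (entryBox n (rightBox b X p u)) (entryBox n (leftBox b X p u))
  rw [if_neg (h1 p (by omega))] at hL
  rw [if_neg (h1 u hu)] at hR
  by_cases h3 : u < p + b
  · have hI := card_right_inter_left_of_lt X hpu hu h3 (h1 p (by omega)) (h1 u hu)
    rw [overlap, if_pos (by omega)]
    omega
  · have hI := card_right_inter_left_of_ge hb X hu (by omega) (h2 p (by omega))
    rw [overlap, if_neg (by omega)]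
    omega

lemma one_add_sum_card_short (hq : 1 ≤ q) (hb : 0 < b) (hn : b ≤ n) (X : ℕ → Fin q) :
    (1 + ∑ s ∈ range n, ((entryBox n (shortBox b X s)).card : ℚ)) =
      (q : ℚ) ^ b + ((n : ℚ) - b) * ((q : ℚ) - 1) * (q : ℚ) ^ (b - 1) := by
  have hcard : ∀ s ∈ range n, ((entryBox n (shortBox b X s)).card : ℚ) =
      ((q : ℚ) - 1) * (q : ℚ) ^ min s (b - 1) := by
    intro s hs
    rw [card_shortBox hb X (by simpa using hs)]
    push_cast [Nat.cast_sub hq]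
    rfl
  rw [sum_congr rfl hcard]
  clear hcard
  induction n, hn using Nat.le_induction with
  | base =>
    have : ∀ s ∈ range b, ((q : ℚ) - 1) * (q : ℚ) ^ min s (b - 1) =
        ((q : ℚ) - 1) * (q : ℚ) ^ s := by
      intro s hs
      rw [min_eq_left (by simp at hs; omega)]
    rw [sum_congr rfl this, ← mul_sum, mul_geom_sum]
    ring
  | succ n hn ih =>
    rw [sum_range_succ, ← add_assoc, ih, min_eq_right (by omega)]
    push_cast
    ring

lemma sum_overlap (hb : 0 < b) (k : ℕ) :
    ((q : ℚ) - 1) * ∑ d ∈ range k, (overlap q b d : ℚ) + (q : ℚ) ^ (b - k) = (q : ℚ) ^ b := by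
  induction k with
  | zero => simp
  | succ k ih =>
    rw [sum_range_succ, ← ih, overlap]
    split_ifs with hk
    · obtain ⟨m, rfl⟩ : ∃ m, b = m + 1 + k := ⟨b - 1 - k, by omega⟩
      rw [show m + 1 + k - 1 - k = m by omega, show m + 1 + k - (k + 1) = m by omega,
        show m + 1 + k - k = m + 1 by omega]
      push_cast
      ring
    · rw [show b - (k + 1) = b - k by omega]
      push_cast
      ring

lemma sum_pow_sub {N : ℕ} (hN : b ≤ N) :
    ((q : ℚ) - 1) * ∑ u ∈ range N, (q : ℚ) ^ (b - (u + 1)) =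
      (q : ℚ) ^ b - 1 + ((N : ℚ) - b) * ((q : ℚ) - 1) := by
  induction N, hN using Nat.le_induction with
  | base =>
    have : ∑ u ∈ range b, (q : ℚ) ^ (b - (u + 1)) = ∑ u ∈ range b, (q : ℚ) ^ u := by
      rw [← sum_range_reflect]
      refine sum_congr rfl fun u hu => ?_
      rw [mem_range] at hu
      congr 1
      omega
    rw [this, mul_geom_sum]
    ring
  | succ N hN ih =>
    rw [sum_range_succ, mul_add, ih, show b - (N + 1) = 0 by omega]
    push_cast
    ring

lemma sum_sum_overlap {N : ℕ} (hb : 0 < b) (hN : b ≤ N) :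
    ((q : ℚ) - 1) ^ 2 * ∑ u ∈ range N, ∑ p ∈ range (u + 1), (overlap q b (u - p) : ℚ) =
      N * (q : ℚ) ^ b * ((q : ℚ) - 1) - ((q : ℚ) ^ b - 1 + ((N : ℚ) - b) * ((q : ℚ) - 1)) := by
  have hinner : ∀ u ∈ range N, ((q : ℚ) - 1) * ∑ p ∈ range (u + 1), (overlap q b (u - p) : ℚ) =
      (q : ℚ) ^ b - (q : ℚ) ^ (b - (u + 1)) := by
    intro u _
    rw [← sum_overlap hb (u + 1), ← sum_range_reflect fun d => (overlap q b d : ℚ)]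
    simp
  rw [sq, mul_assoc, mul_sum (range N), sum_congr rfl hinner, sum_sub_distrib, mul_sub,
    sum_pow_sub hN]
  simp
  ring

lemma levBall_eq_image (hb : 0 < b) (hn : b ≤ n) (x : List (Fin q)) (hx : x.length = n)
    (X : ℕ → Fin q) (hX : ∀ i < n, x[i]? = some (X i)) :
    levBall q b 1 x = List.ofFn '' (ballFinset n b X : Set (Fin n → Fin q)) := by
  ext z
  simp only [Set.mem_image, mem_coe, mem_ballFinset hb hn]
  have key : z ∈ levBall q b 1 x ↔ z.length = n ∧ ∃ i j, i + b ≤ n ∧ j + b ≤ n ∧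
      z.take j ++ z.drop (j + b) = x.take i ++ x.drop (i + b) := by
    simp only [levBall, delBall, insBall, relIter, BurstDel, BurstIns, Set.mem_ofPred_eq]
    constructor
    · rintro ⟨y, ⟨y', ⟨i, hi, rfl⟩, rfl⟩, z', ⟨j, v, hj, hv, rfl⟩, rfl⟩
      have hlen : (x.take i ++ x.drop (i + b)).length = n - b := by
        simp; omega
      generalize hy : x.take i ++ x.drop (i + b) = y at *
      refine ⟨by simp; omega, i, j, by omega, by omega, ?_⟩
      have : (y.take j).length = j := by simp; omega
      rw [List.append_assoc, List.take_append_of_le_length (by omega), List.drop_append,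
        List.drop_append, this]
      rw [hy]
      simp [hv, List.drop_of_length_le, this, List.take_take]
    · rintro ⟨hz, i, j, hi, hj, h⟩
      refine ⟨_, ⟨_, ⟨i, by omega, rfl⟩, rfl⟩, z, ⟨j, (z.drop j).take b, ?_, ?_, ?_⟩, rfl⟩
      · rw [← h]; simp; omega
      · simp; omega
      · rw [← h]
        have : (z.take j).length = j := by simp; omega
        rw [List.take_append_of_le_length (by omega), List.drop_append, this]
        simp [List.take_take, List.drop_of_length_le, ← List.drop_drop]
  have conv : ∀ g : Fin n → Fin q, (∃ i j, i + b ≤ n ∧ j + b ≤ n ∧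
      (List.ofFn g).take j ++ (List.ofFn g).drop (j + b) = x.take i ++ x.drop (i + b)) ↔
      CommonDel n b X (extendBy X g) := by
    intro g
    unfold CommonDel
    have hG : ∀ i < n, (List.ofFn g)[i]? = some (extendBy X g i) := by
      intro i hi
      simp [extendBy, hi]
    have hlen : (List.ofFn g).length = n := by simp
    generalize List.ofFn g = w at *
    have hget : ∀ (w : List (Fin q)) (W : ℕ → Fin q), w.length = n →
        (∀ i < n, w[i]? = some (W i)) → ∀ j, j + b ≤ n → ∀ t, t + b < n →
        (w.take j ++ w.drop (j + b))[t]? = some (if t < j then W t else W (t + b)) := by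
      intro w W hw hW j hj t ht
      rw [List.getElem?_append]
      have h1 := hW t (by omega)
      have h2 := hW (t + b) (by omega)
      have : (w.take j).length = j := by simp; omega
      rw [this]
      split_ifs with htj
      · rw [List.getElem?_take_of_lt htj, h1]
      · rw [List.getElem?_drop, ← h2]
        congr 1
        omega
    refine exists_congr fun i => exists_congr fun j => and_congr_right fun hi =>
      and_congr_right fun hj => ⟨fun h t ht => ?_, fun h => ?_⟩
    · have h1 := hget w _ hlen hG j hj t ht
      rw [h, hget x _ hx hX i hi t ht] at h1
      exact (Option.some.inj h1).symm
    · apply List.ext_getElem?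
      intro t
      by_cases ht : t + b < n
      · rw [hget w _ hlen hG j hj t ht, hget x _ hx hX i hi t ht, h t ht]
      · rw [List.getElem?_eq_none (by simp; omega), List.getElem?_eq_none (by simp; omega)]
  rw [key]
  constructor
  · rintro ⟨rfl, h⟩
    refine ⟨z.get, ?_, by simp⟩
    rw [← conv]
    simpa using h
  · rintro ⟨g, hg, rfl⟩
    exact ⟨by simp, (conv g).2 hg⟩

lemma card_ballFinset_add_overlap (hq : 2 ≤ q) (hb : 0 < b) (X : ℕ → Fin q) :
    (ballFinset n b X).card +
        ∑ u ∈ range (n - b), ∑ p ∈ range (u + 1), overlap q b (u - p) ≤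
      1 + ∑ s ∈ range n, (entryBox n (shortBox b X s)).card +
        ∑ u ∈ range (n - b), ∑ _p ∈ range (u + 1), 2 * ((q - 1) * q ^ (b - 1)) ∧
    ((∀ i, i + b < n → X i ≠ X (i + b)) → (∀ i, i + 2 * b < n → X i ≠ X (i + 2 * b)) →
      (ballFinset n b X).card +
          ∑ u ∈ range (n - b), ∑ p ∈ range (u + 1), overlap q b (u - p) =
        1 + ∑ s ∈ range n, (entryBox n (shortBox b X s)).card +
          ∑ u ∈ range (n - b), ∑ _p ∈ range (u + 1), 2 * ((q - 1) * q ^ (b - 1))) := by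
  rw [card_ballFinset hb, add_assoc (1 + _), ← sum_add_distrib]
  simp_rw [← sum_add_distrib]
  refine ⟨?_, fun h1 h2 => ?_⟩
  · gcongr with u hu p hp
    rw [mem_range] at hu hp
    exact card_union_add_overlap_le hq hb X (by omega) (by omega)
  · congr 1
    refine sum_congr rfl fun u hu => sum_congr rfl fun p hp => ?_
    rw [mem_range] at hu hp
    exact card_union_add_overlap_eq hb X (by omega) (by omega) h1 h2

lemma sum_range_sum_range_succ_const (N : ℕ) (K : ℚ) :
    ∑ u ∈ range N, ∑ _p ∈ range (u + 1), 2 * K = N * (N + 1) * K := by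
  induction N with
  | zero => simp
  | succ N ih =>
    rw [sum_range_succ, ih]
    simp only [sum_const, card_range, nsmul_eq_mul]
    push_cast
    ring

lemma ball_bound_eq (hq : 2 ≤ q) (hb : 0 < b) (hn : 2 * b ≤ n) (X : ℕ → Fin q) :
    (((1 + ∑ s ∈ range n, (entryBox n (shortBox b X s)).card +
        ∑ u ∈ range (n - b), ∑ _p ∈ range (u + 1), 2 * ((q - 1) * q ^ (b - 1)) : ℕ) : ℚ)) -
        ((∑ u ∈ range (n - b), ∑ p ∈ range (u + 1), overlap q b (u - p) : ℕ) : ℚ) =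
      (q : ℚ) ^ (b - 1) * ((n : ℚ) - b + 1) * (((n : ℚ) - b + 1) * ((q : ℚ) - 1) - 1)
        + 2 * (q : ℚ) ^ (b - 1)
        - ((n : ℚ) - b) * ((q : ℚ) ^ (b - 1) - 1) / ((q : ℚ) - 1)
        + ((q : ℚ) ^ b - q - ((b : ℚ) - 1) * ((q : ℚ) - 1)) / ((q : ℚ) - 1) ^ 2 := by
  have hq1 : (q : ℚ) - 1 ≠ 0 := by
    have : (2 : ℚ) ≤ q := by exact_mod_cast hq
    linarith
  have hE := sum_sum_overlap (q := q) (N := n - b) hb (by omega)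
  rw [mul_comm, ← eq_div_iff (pow_ne_zero 2 hq1)] at hE
  push_cast
  rw [hE, sum_range_sum_range_succ_const, one_add_sum_card_short (by omega) hb (by omega),
    Nat.cast_sub (by omega : b ≤ n), Nat.cast_sub (by omega : 1 ≤ q)]
  obtain ⟨c, rfl⟩ : ∃ c, b = c + 1 := ⟨b - 1, by omega⟩
  rw [Nat.add_sub_cancel]
  push_cast
  field_simp
  ring

end BurstBall

/-- refined upper bound `M` for `q ≥ 3`, attained whenever
`x_i ≠ x_{i+b}` for all `i ∈ [1, n-b]` and `x_i ≠ x_{i+2b}` for all `i ∈ [1, n-2b]`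
(indices 0-based below). -/
theorem levBall_card_max (q b n : ℕ) (hq : 3 ≤ q) (hb : 2 ≤ b) (hn : 2 * b + 1 ≤ n)
    (x : List (Fin q)) (hx : x.length = n) :
    ((levBall q b 1 x).ncard : ℚ) ≤
        (q : ℚ) ^ (b - 1) * ((n : ℚ) - b + 1) * (((n : ℚ) - b + 1) * ((q : ℚ) - 1) - 1)
          + 2 * (q : ℚ) ^ (b - 1)
          - ((n : ℚ) - b) * ((q : ℚ) ^ (b - 1) - 1) / ((q : ℚ) - 1)
          + ((q : ℚ) ^ b - q - ((b : ℚ) - 1) * ((q : ℚ) - 1)) / ((q : ℚ) - 1) ^ 2 ∧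
      ((∀ i, i + b < n → x[i]? ≠ x[i + b]?) →
        (∀ i, i + 2 * b < n → x[i]? ≠ x[i + 2 * b]?) →
        ((levBall q b 1 x).ncard : ℚ) =
          (q : ℚ) ^ (b - 1) * ((n : ℚ) - b + 1) * (((n : ℚ) - b + 1) * ((q : ℚ) - 1) - 1)
            + 2 * (q : ℚ) ^ (b - 1)
            - ((n : ℚ) - b) * ((q : ℚ) ^ (b - 1) - 1) / ((q : ℚ) - 1)
            + ((q : ℚ) ^ b - q - ((b : ℚ) - 1) * ((q : ℚ) - 1)) / ((q : ℚ) - 1) ^ 2) := by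
  obtain ⟨X, hX⟩ : ∃ X : ℕ → Fin q, ∀ i < n, x[i]? = some (X i) :=
    ⟨fun i => x.getD i ⟨0, by omega⟩, fun i hi => by simp [hx, hi]⟩
  have hM := ball_bound_eq (by omega : 2 ≤ q) (by omega : 0 < b) (by omega : 2 * b ≤ n) X
  obtain ⟨hle, heq⟩ :=
    card_ballFinset_add_overlap (n := n) (by omega : 2 ≤ q) (by omega : 0 < b) X
  rw [levBall_eq_image (by omega) (by omega) x hx X hX,
    Set.ncard_image_of_injective _ List.ofFn_injective, Set.ncard_coe_finset, ← hM]
  refine ⟨?_, fun h1 h2 => ?_⟩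
  · rw [le_sub_iff_add_le]
    exact_mod_cast hle
  · rw [eq_sub_iff_add_eq]
    refine mod_cast heq (fun i hi h => h1 i hi ?_) (fun i hi h => h2 i hi ?_)
    · rw [hX i (by omega), hX _ hi, h]
    · rw [hX i (by omega), hX _ hi, h]
end

section
/- Let X_1, X_2, …, X_m be finite subsets of an arbitrary type such that for all indices 1 ≤ i < j < k ≤ m the triple intersection X_i ∩ X_j ∩ X_k does not depend on the middle index, i.e., X_i ∩ X_j ∩ X_k = X_i ∩ X_{i+1} ∩ X_k. Then |X_1 ∪ X_2 ∪ ⋯ ∪ X_m| = Σ_{i=1}^{m} |X_i| − Σ_{i=1}^{m−1} |X_i ∩ X_{i+1}| − Σ_{i=1}^{m} Σ_{j=i+2}^{m} |(X_i ∩ X_j) \ (X_i ∩ X_{i+1})|. -/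
/-- The union of a finite sequence of sets, counted by adding the sets one at a time from the
right. -/
theorem card_biUnion_Icc_eq_sum {α : Type*} [DecidableEq α] (X : ℕ → Finset α) (a m : ℕ) :
    (((Finset.Icc a m).biUnion X).card : ℤ) =
      ∑ i ∈ Finset.Icc a m,
        (((X i).card : ℤ) - ((X i ∩ (Finset.Icc (i + 1) m).biUnion X).card : ℤ)) := by
  induction hd : m + 1 - a generalizing a with
  | zero => simp [Finset.Icc_eq_empty (show ¬a ≤ m by lia)]
  | succ d ih =>
    have ham : a ≤ m := by lia
    rw [← Finset.insert_Icc_add_one_left_eq_Icc ham, Finset.biUnion_insert,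
      Finset.sum_insert (by simp), ← ih (a + 1) (by lia)]
    have := Finset.card_union_add_card_inter (X a) ((Finset.Icc (a + 1) m).biUnion X)
    lia

/-- If every two of the traces `A ∩ X j`, `j ∈ s`, meet inside `B`, then the part of `A` covered
by `B` and the `X j` is counted by `A ∩ B` and the traces outside `B`. -/
theorem card_inter_union_biUnion {α ι : Type*} [DecidableEq α] (A B : Finset α)
    (s : Finset ι) (X : ι → Finset α)
    (h : ∀ j ∈ s, ∀ k ∈ s, j ≠ k → A ∩ X j ∩ X k ⊆ B) :
    (A ∩ (B ∪ s.biUnion X)).card =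
      (A ∩ B).card + ∑ j ∈ s, ((A ∩ X j) \ (A ∩ B)).card := by
  rw [← Finset.card_biUnion, ← Finset.card_union_of_disjoint]
  · congr 1
    ext x
    simp only [Finset.mem_inter, Finset.mem_union, Finset.mem_biUnion, Finset.mem_sdiff]
    grind
  · simp only [Finset.disjoint_biUnion_right]
    exact fun j _ => Finset.disjoint_sdiff
  · intro j hj k hk hjk
    refine Finset.disjoint_left.mpr fun x hx hx' => ?_
    have := @h j hj k hk hjk x
    grind

/-- inclusion–exclusion identity for a family of finite sets whose
triple intersections do not depend on the middle index. -/
theorem inclusion_exclusion_chain {α : Type*} [DecidableEq α] (m : ℕ) (X : ℕ → Finset α)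
    (h : ∀ i j k, 1 ≤ i → i < j → j < k → k ≤ m →
      X i ∩ X j ∩ X k = X i ∩ X (i + 1) ∩ X k) :
    (((Finset.Icc 1 m).biUnion X).card : ℤ) =
      ∑ i ∈ Finset.Icc 1 m, ((X i).card : ℤ)
        - ∑ i ∈ Finset.Icc 1 (m - 1), ((X i ∩ X (i + 1)).card : ℤ)
        - ∑ i ∈ Finset.Icc 1 m, ∑ j ∈ Finset.Icc (i + 2) m,
            (((X i ∩ X j) \ (X i ∩ X (i + 1))).card : ℤ) := by
  have middle : ∑ i ∈ Finset.Icc 1 (m - 1), ((X i ∩ X (i + 1)).card : ℤ) =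
      ∑ i ∈ Finset.Icc 1 m, if i < m then ((X i ∩ X (i + 1)).card : ℤ) else 0 := by
    rw [← Finset.sum_filter]
    congr 1
    ext i
    simp only [Finset.mem_Icc, Finset.mem_filter]
    lia
  rw [card_biUnion_Icc_eq_sum, middle, ← Finset.sum_sub_distrib, ← Finset.sum_sub_distrib]
  refine Finset.sum_congr rfl fun i hi => ?_
  obtain ⟨hi1, him⟩ := Finset.mem_Icc.mp hi
  rcases him.eq_or_lt with rfl | him
  · simp
  have triple : ∀ j k, i + 2 ≤ j → j < k → k ≤ m → X i ∩ X j ∩ X k ⊆ X (i + 1) := by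
    intro j k hij hjk hkm
    rw [h i j k hi1 (by lia) hjk hkm]
    exact Finset.inter_subset_left.trans Finset.inter_subset_right
  have key := card_inter_union_biUnion (X i) (X (i + 1)) (Finset.Icc (i + 2) m) X (by
    intro j hj k hk hjk
    rw [Finset.mem_Icc] at hj hk
    rcases hjk.lt_or_gt with hlt | hlt
    · exact triple j k hj.1 hlt hk.2
    · rw [Finset.inter_right_comm]
      exact triple k j hk.1 hlt hj.2)
  rw [← Finset.insert_Icc_add_one_left_eq_Icc (show i + 1 ≤ m from him),
    Finset.biUnion_insert, show i + 1 + 1 = i + 2 from rfl, key, if_pos him]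
  push_cast
  ring
end

section
/- Let q ≥ 2, b ≥ 2 and n ≥ 2b+1, and for x ∈ Σ_q^n define h(x) = q^{b−1}((n−b+1)(q−1)−1)·r_b(x) + 2q^{b−1} − Σ_{j=1}^{b−1} q^{b−j−1} f_{b,j}(x). Then for any x, x' ∈ Σ_q^n with r_b(x) > r_b(x'), one has h(x) > h(x'). -/
/-- The auxiliary quantity
`h(x) = q^{b-1}((n-b+1)(q-1)-1) r_b(x) + 2 q^{b-1} - Σ_{j=1}^{b-1} q^{b-j-1} f_{b,j}(x)`. -/
def hAux (q b n : ℕ) (x : List (Fin q)) : ℤ :=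
  (q : ℤ) ^ (b - 1) * (((n : ℤ) - b + 1) * ((q : ℤ) - 1) - 1) * rB q b x
    + 2 * (q : ℤ) ^ (b - 1)
    - ∑ j ∈ Finset.Icc 1 (b - 1), (q : ℤ) ^ (b - j - 1) * fB q b j x

theorem fB_le (q b j : ℕ) (x : List (Fin q)) : fB q b j x ≤ x.length - b :=
  (Finset.card_filter_le _ _).trans (by simp)

theorem sum_Icc_pow_sub_lt {q b : ℕ} (hq : 2 ≤ q) :
    ∑ j ∈ Finset.Icc 1 (b - 1), q ^ (b - j - 1) < q ^ (b - 1) := by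
  have hinj : Set.InjOn (fun j => b - j - 1) (Finset.Icc 1 (b - 1) : Finset ℕ) := by
    intro i hi j hj hij
    simp only [Finset.coe_Icc, Set.mem_Icc] at hi hj hij
    omega
  rw [← Finset.sum_image (f := fun k => q ^ k) hinj]
  refine Nat.geomSum_lt hq fun k hk => ?_
  simp only [Finset.mem_image, Finset.mem_Icc] at hk
  omega

theorem sum_pow_mul_fB_lt {q b : ℕ} (hq : 2 ≤ q) (x : List (Fin q)) (hx : b < x.length) :
    ∑ j ∈ Finset.Icc 1 (b - 1), q ^ (b - j - 1) * fB q b j x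
      < q ^ (b - 1) * (x.length - b) :=
  calc ∑ j ∈ Finset.Icc 1 (b - 1), q ^ (b - j - 1) * fB q b j x
      ≤ ∑ j ∈ Finset.Icc 1 (b - 1), q ^ (b - j - 1) * (x.length - b) :=
        Finset.sum_le_sum fun j _ => Nat.mul_le_mul_left _ (fB_le q b j x)
    _ = (∑ j ∈ Finset.Icc 1 (b - 1), q ^ (b - j - 1)) * (x.length - b) :=
        (Finset.sum_mul ..).symm
    _ < q ^ (b - 1) * (x.length - b) :=
        Nat.mul_lt_mul_of_pos_right (sum_Icc_pow_sub_lt hq) (by omega)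

/-- `h` is strictly increasing in the number of `b`-runs. -/
theorem hAux_strict_mono (q b n : ℕ) (hq : 2 ≤ q) (hb : 2 ≤ b) (hn : 2 * b + 1 ≤ n)
    (x x' : List (Fin q)) (hx : x.length = n) (hx' : x'.length = n)
    (hr : rB q b x' < rB q b x) :
    hAux q b n x' < hAux q b n x := by
  have hsum : ∑ j ∈ Finset.Icc 1 (b - 1), (q : ℤ) ^ (b - j - 1) * fB q b j x
      < (q : ℤ) ^ (b - 1) * ((n : ℤ) - b) := by
    have h := sum_pow_mul_fB_lt (b := b) hq x (by omega)
    rw [hx] at h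
    zify [show b ≤ n by omega] at h
    exact h
  have hsum' : 0 ≤ ∑ j ∈ Finset.Icc 1 (b - 1), (q : ℤ) ^ (b - j - 1) * fB q b j x' := by
    positivity
  have hm : (0 : ℤ) ≤ (n : ℤ) - b := by omega
  have hq' : (2 : ℤ) ≤ q := by exact_mod_cast hq
  have hcoeff : (n : ℤ) - b ≤ ((n : ℤ) - b + 1) * ((q : ℤ) - 1) - 1 := by nlinarith
  have hr' : (rB q b x' : ℤ) + 1 ≤ rB q b x := by exact_mod_cast hr
  have hpow : (0 : ℤ) ≤ (q : ℤ) ^ (b - 1) := by positivity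
  have hlead := mul_le_mul_of_nonneg_left hcoeff hpow
  have hruns := mul_le_mul_of_nonneg_left hr' ((mul_nonneg hpow hm).trans hlead)
  unfold hAux
  linarith
end

section
/- Let q ≥ 2, b ≥ 1 and n ≥ b+1. For every x ∈ Σ_q^n, the b-burst-deletion ball of radius one satisfies |D_1^b(x)| = 1 + |{i ∈ [1, n−b] : x_i ≠ x_{i+b}}|; in particular |D_1^b(x)| ≤ n−b+1. -/
theorem List.getElem?_take_append_drop_add {α : Type*} (x : List α) {b k : ℕ}
    (hk : k ≤ x.length) (j : ℕ) :
    (x.take k ++ x.drop (k + b))[j]? = if j < k then x[j]? else x[j + b]? := by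
  rw [List.getElem?_append, List.length_take, min_eq_left hk]
  split_ifs with h
  · simp [h]
  · rw [List.getElem?_drop]
    congr 1
    omega

/-- Deleting the burst at position `k` or at position `k + 1` gives the same sequence when
the entries at `k` and `k + b` agree; otherwise the latter deletion is new. -/
theorem card_image_take_append_drop {α : Type*} [DecidableEq α] (x : List α) (b m : ℕ)
    (hm : m ≤ x.length) :
    ((Finset.range (m + 1)).image fun k => x.take k ++ x.drop (k + b)).card =
      1 + ((Finset.range m).filter fun i => x[i]? ≠ x[i + b]?).card := by
  induction m with
  | zero => simp
  | succ m ih =>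
    rw [Finset.range_add_one, Finset.image_insert, Finset.range_add_one (n := m),
      Finset.filter_insert, ← Finset.range_add_one]
    by_cases h : x[m]? = x[m + b]?
    · rw [if_neg (not_not.mpr h), ← ih (by omega), Finset.insert_eq_of_mem]
      refine Finset.mem_image.mpr ⟨m, by simp, List.ext_getElem? fun j => ?_⟩
      rw [List.getElem?_take_append_drop_add x (by omega),
        List.getElem?_take_append_drop_add x hm]
      rcases lt_trichotomy j m with hj | rfl | hj
      · rw [if_pos hj, if_pos (by omega)]
      · simp [h]
      · rw [if_neg (by omega), if_neg (by omega)]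
    · rw [if_pos h, Finset.card_insert_of_notMem (a := m) (by simp),
        Finset.card_insert_of_notMem, ih (by omega), add_assoc]
      intro hmem
      obtain ⟨k, hk, hkm⟩ := Finset.mem_image.mp hmem
      rw [Finset.mem_range] at hk
      have hkm' := congrArg (fun l : List α => l[m]?) hkm
      rw [List.getElem?_take_append_drop_add x (by omega),
        List.getElem?_take_append_drop_add x hm, if_neg (by omega), if_pos (by omega)] at hkm'
      exact h hkm'.symm

theorem delBall_one_eq_image {q b : ℕ} (x : List (Fin q)) (hb : b ≤ x.length) :
    delBall q b 1 x =
      ((Finset.range (x.length - b + 1)).image fun k => x.take k ++ x.drop (k + b)) := by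
  ext y
  simp only [delBall, relIter, BurstDel, Set.mem_ofPred_eq, exists_eq_right, Finset.coe_image,
    Set.mem_image, Finset.mem_coe, Finset.mem_range]
  refine exists_congr fun i => and_congr (by omega) eq_comm

/-- size of the `b`-burst-deletion ball of radius one
(indices 0-based: `i ∈ [0, n-b-1]` corresponds to `i+1 ∈ [1, n-b]`). -/
theorem delBall_card (q b n : ℕ) (hq : 2 ≤ q) (hb : 1 ≤ b) (hn : b + 1 ≤ n)
    (x : List (Fin q)) (hx : x.length = n) :
    (delBall q b 1 x).ncard =
        1 + ((Finset.range (n - b)).filter fun i => x[i]? ≠ x[i + b]?).card ∧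
      (delBall q b 1 x).ncard ≤ n - b + 1 := by
  subst hx
  have hcard : (delBall q b 1 x).ncard =
      1 + ((Finset.range (x.length - b)).filter fun i => x[i]? ≠ x[i + b]?).card := by
    rw [delBall_one_eq_image x (by omega), Set.ncard_coe_finset,
      card_image_take_append_drop x b _ (Nat.sub_le _ _)]
  refine ⟨hcard, ?_⟩
  have hle := Finset.card_filter_le (Finset.range (x.length - b)) fun i => x[i]? ≠ x[i + b]?
  rw [Finset.card_range] at hle
  omega
end
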